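/- arXiv:0704.1691 — 4 statements merged into one kernel-verified Lean document; each statement's English description precedes it below -/
import Mathlib

section
/- Let A ∈ SM(n, ℂ) and let P ∈ ℂ[z_1, …, z_n] be Δ_A-nilpotent with zero constant and linear terms (o(P) ≥ 2). Then the following are equivalent: (1) Δ_A^m(P^{m+1}) = 0 for all sufficiently large m; (2) there exists k_0 ≥ 1 such that Δ_A^m(P^{m+k_0}) = 0 for all sufficiently large m; (3) for every fixed k ≥ 1, Δ_A^m(P^{m+k}) = 0 for all sufficiently large m. -/
open MvPolynomial

noncomputable def Delta {n : ℕ} (A : Matrix (Fin n) (Fin n) ℂ) :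
    Module.End ℂ (MvPolynomial (Fin n) ℂ) :=
  ∑ i, ∑ j, A i j • ((pderiv i).toLinearMap ∘ₗ (pderiv j).toLinearMap)

/-- `P` is `Λ`-nilpotent: `Λ^m(P^m) = 0` for all `m ≥ 1`. -/
def LNil {n : ℕ} (Λ : Module.End ℂ (MvPolynomial (Fin n) ℂ))
    (P : MvPolynomial (Fin n) ℂ) : Prop :=
  ∀ m : ℕ, 1 ≤ m → (Λ ^ m) (P ^ m) = 0

/-- `o(P) ≥ 2`: `P` has no constant term and no linear term. -/
def OrdGe2 {n : ℕ} (P : MvPolynomial (Fin n) ℂ) : Prop :=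
  ∀ d : Fin n →₀ ℕ, (d.sum fun _ k => k) < 2 → MvPolynomial.coeff d P = 0

/-- The coefficientwise extension of a derivation of `S` to power series over `S`. -/
noncomputable def coeffDeriv {S : Type*} [CommRing S] [Algebra ℂ S] (D : Derivation ℂ S S) :
    Derivation ℂ (PowerSeries S) (PowerSeries S) :=
  Derivation.mk'
    { toFun := fun F => PowerSeries.mk fun m => D (PowerSeries.coeff m F)
      map_add' := fun F G => by ext m; simp
      map_smul' := fun c F => by ext m; simp }
    (fun F G => by
      ext m
      simp only [LinearMap.coe_mk, AddHom.coe_mk, PowerSeries.coeff_mk, smul_eq_mul, map_add,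
        PowerSeries.coeff_mul, map_sum, Derivation.leibniz, Finset.sum_add_distrib]
      congr 1
      exact (Finset.Nat.sum_antidiagonal_swap
        (f := fun x => PowerSeries.coeff x.1 G * D (PowerSeries.coeff x.2 F))).symm ▸ rfl)

lemma coeff_coeffDeriv {S : Type*} [CommRing S] [Algebra ℂ S] (D : Derivation ℂ S S)
    (F : PowerSeries S) (m : ℕ) :
    PowerSeries.coeff m (coeffDeriv D F) = D (PowerSeries.coeff m F) := by
  simp [coeffDeriv]

lemma Derivation.comp_pow {R : Type*} [CommRing R] [Algebra ℂ R] (D E : Derivation ℂ R R)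
    (F : R) (k : ℕ) :
    D (E (F ^ (k + 2))) =
      (k + 2) * (k + 1) * F ^ k * (D F * E F) + (k + 2) * F ^ (k + 1) * D (E F) := by
  simp only [Derivation.leibniz_pow, Derivation.leibniz, smul_eq_mul, nsmul_eq_mul,
    Derivation.map_natCast, Nat.add_sub_cancel, show k + 2 - 1 = k + 1 from rfl]
  push_cast
  ring

/-- The coefficientwise extension of `Delta A` to power series. -/
noncomputable def coeffDelta {n : ℕ} (A : Matrix (Fin n) (Fin n) ℂ)
    (F : PowerSeries (MvPolynomial (Fin n) ℂ)) : PowerSeries (MvPolynomial (Fin n) ℂ) :=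
  ∑ i, ∑ j, A i j • coeffDeriv (pderiv i) (coeffDeriv (pderiv j) F)

/-- The quadratic form `∑ a_{ij} D_i F D_j F` on power series. -/
noncomputable def gradForm {n : ℕ} (A : Matrix (Fin n) (Fin n) ℂ)
    (F : PowerSeries (MvPolynomial (Fin n) ℂ)) : PowerSeries (MvPolynomial (Fin n) ℂ) :=
  ∑ i, ∑ j, A i j • (coeffDeriv (pderiv i) F * coeffDeriv (pderiv j) F)

lemma coeff_coeffDelta {n : ℕ} (A : Matrix (Fin n) (Fin n) ℂ)
    (F : PowerSeries (MvPolynomial (Fin n) ℂ)) (m : ℕ) :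
    PowerSeries.coeff m (coeffDelta A F) = Delta A (PowerSeries.coeff m F) := by
  simp [coeffDelta, Delta, coeff_coeffDeriv, LinearMap.sum_apply]

lemma coeffDelta_pow {n : ℕ} (A : Matrix (Fin n) (Fin n) ℂ)
    {F : PowerSeries (MvPolynomial (Fin n) ℂ)} (hF : coeffDelta A F = 0) (k : ℕ) :
    coeffDelta A (F ^ (k + 2)) = (((k : ℂ) + 2) * (k + 1)) • (F ^ k * gradForm A F) := by
  have h : coeffDelta A (F ^ (k + 2)) = (k + 2) * (k + 1) * F ^ k * gradForm A F
      + (k + 2) * F ^ (k + 1) * coeffDelta A F := by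
    simp only [coeffDelta, gradForm, Derivation.comp_pow, smul_add, Finset.sum_add_distrib,
      Finset.mul_sum, mul_smul_comm]
  rw [h, hF, mul_zero, add_zero, Algebra.smul_def]
  simp only [map_mul, map_add, map_natCast, map_one, map_ofNat, mul_assoc]

/-- The normalised coefficients `Δ^m(P^{m+k}) / (m! (m+k)!)`. -/
noncomputable def deformCoeff {n : ℕ} (Λ : Module.End ℂ (MvPolynomial (Fin n) ℂ))
    (P : MvPolynomial (Fin n) ℂ) (k m : ℕ) : MvPolynomial (Fin n) ℂ :=
  ((m.factorial : ℂ) * ((m + k).factorial : ℂ))⁻¹ • (Λ ^ m) (P ^ (m + k))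

lemma deformCoeff_eq_zero_iff {n : ℕ} (Λ : Module.End ℂ (MvPolynomial (Fin n) ℂ))
    (P : MvPolynomial (Fin n) ℂ) (k m : ℕ) :
    deformCoeff Λ P k m = 0 ↔ (Λ ^ m) (P ^ (m + k)) = 0 := by
  simp [deformCoeff, Nat.factorial_ne_zero]

lemma apply_deformCoeff {n : ℕ} (Λ : Module.End ℂ (MvPolynomial (Fin n) ℂ))
    (P : MvPolynomial (Fin n) ℂ) (k m : ℕ) :
    Λ (deformCoeff Λ P (k + 1) m) = ((m : ℂ) + 1) • deformCoeff Λ P k (m + 1) := by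
  have h1 : (m.factorial : ℂ) ≠ 0 := by exact_mod_cast m.factorial_ne_zero
  have h2 : ((m + 1 + k).factorial : ℂ) ≠ 0 := by exact_mod_cast (m + 1 + k).factorial_ne_zero
  have h3 : (m : ℂ) + 1 ≠ 0 := by exact_mod_cast m.succ_ne_zero
  rw [deformCoeff, deformCoeff, map_smul, smul_smul, pow_succ' Λ, Module.End.mul_apply,
    show m + (k + 1) = m + 1 + k by ring, Nat.factorial_succ m]
  congr 1
  push_cast
  field_simp

/-- The generating series of the coefficients `deformCoeff Λ P 1`. -/
noncomputable def deform {n : ℕ} (Λ : Module.End ℂ (MvPolynomial (Fin n) ℂ))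
    (P : MvPolynomial (Fin n) ℂ) : PowerSeries (MvPolynomial (Fin n) ℂ) :=
  PowerSeries.mk (deformCoeff Λ P 1)

lemma coeffDelta_deform {n : ℕ} (A : Matrix (Fin n) (Fin n) ℂ) {P : MvPolynomial (Fin n) ℂ}
    (hnil : LNil (Delta A) P) : coeffDelta A (deform (Delta A) P) = 0 := by
  ext1 m
  rw [coeff_coeffDelta, deform, PowerSeries.coeff_mk, apply_deformCoeff,
    (deformCoeff_eq_zero_iff _ _ _ _).2 (hnil (m + 1) (by omega))]
  simp

lemma coeff_deform_pow {n : ℕ} (A : Matrix (Fin n) (Fin n) ℂ) {P : MvPolynomial (Fin n) ℂ}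
    (hnil : LNil (Delta A) P) (m k : ℕ) :
    PowerSeries.coeff m (deform (Delta A) P ^ k) =
      (k.factorial : ℂ) • deformCoeff (Delta A) P k m := by
  induction m using Nat.strong_induction_on generalizing k with
  | _ m ih =>
  rcases m with _ | j
  · simp [deform, deformCoeff, PowerSeries.coeff_zero_eq_constantCoeff, smul_smul,
      Nat.factorial_ne_zero]
  rcases k with _ | k
  · rw [(deformCoeff_eq_zero_iff _ _ _ _).2 (hnil (j + 1) (by omega))]
    simp [PowerSeries.coeff_one]
  set R := deform (Delta A) P with hR
  have hharm : coeffDelta A R = 0 := coeffDelta_deform A hnil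
  -- the evolution equation `∂_t R = ∑ a_{ij} D_i R D_j R`, up to order `j`
  have hevol : ∀ i ≤ j, PowerSeries.coeff i (gradForm A R) =
      PowerSeries.coeff i (PowerSeries.derivative (MvPolynomial (Fin n) ℂ) R) := by
    intro i hi
    have h := congrArg (PowerSeries.coeff i) (coeffDelta_pow A hharm 0)
    rw [coeff_coeffDelta, ih i (by omega), map_smul, apply_deformCoeff,
      LinearMap.map_smul_of_tower, pow_zero, one_mul] at h
    have hc : PowerSeries.coeff i (PowerSeries.derivative (MvPolynomial (Fin n) ℂ) R) =
        ((i : ℂ) + 1) • deformCoeff (Delta A) P 1 (i + 1) := by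
      rw [PowerSeries.coeff_derivative, hR, deform, PowerSeries.coeff_mk, Algebra.smul_def,
        mul_comm]
      simp
    rw [hc]
    apply smul_right_injective _ (two_ne_zero : (2 : ℂ) ≠ 0)
    norm_num at h ⊢
    exact h.symm
  have hstep : PowerSeries.coeff j (R ^ k * gradForm A R) =
      PowerSeries.coeff j (R ^ k * PowerSeries.derivative (MvPolynomial (Fin n) ℂ) R) := by
    rw [PowerSeries.coeff_mul, PowerSeries.coeff_mul]
    refine Finset.sum_congr rfl fun x hx => ?_
    rw [hevol x.2 (by have := Finset.HasAntidiagonal.mem_antidiagonal.1 hx; omega)]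
  have hΔ := congrArg (PowerSeries.coeff j) (coeffDelta_pow A hharm k)
  rw [coeff_coeffDelta, ih j (by omega), map_smul, apply_deformCoeff,
    LinearMap.map_smul_of_tower, hstep, Nat.factorial_succ (k + 1)] at hΔ
  have hd : ((j : ℂ) + 1) • PowerSeries.coeff (j + 1) (R ^ (k + 1)) = ((k : ℂ) + 1) •
      PowerSeries.coeff j (R ^ k * PowerSeries.derivative (MvPolynomial (Fin n) ℂ) R) := by
    have h := congrArg (PowerSeries.coeff j)
      (Derivation.leibniz_pow (PowerSeries.derivative (MvPolynomial (Fin n) ℂ)) R (k + 1))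
    rw [PowerSeries.coeff_derivative, map_nsmul, Nat.add_sub_cancel, smul_eq_mul,
      nsmul_eq_mul] at h
    rw [Algebra.smul_def, Algebra.smul_def, mul_comm]
    simpa using h
  have hj : ((j : ℂ) + 1) * (k + 2) ≠ 0 := by
    have h1 : (j : ℂ) + 1 ≠ 0 := by exact_mod_cast j.succ_ne_zero
    have h2 : (k : ℂ) + 2 ≠ 0 := by exact_mod_cast (k + 1).succ_ne_zero
    exact mul_ne_zero h1 h2
  apply smul_right_injective _ hj
  push_cast at hΔ
  simp only
  linear_combination (norm := module) ((k : ℂ) + 2) • hd - hΔ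

lemma eventually_of_eventually_one {n : ℕ} (A : Matrix (Fin n) (Fin n) ℂ) {P : MvPolynomial (Fin n) ℂ}
    (hnil : LNil (Delta A) P)
    (h : ∃ N : ℕ, ∀ m : ℕ, N ≤ m → ((Delta A) ^ m) (P ^ (m + 1)) = 0) (k : ℕ) :
    ∃ N : ℕ, ∀ m : ℕ, N ≤ m → ((Delta A) ^ m) (P ^ (m + k)) = 0 := by
  obtain ⟨N, hN⟩ := h
  have hpoly : ((PowerSeries.trunc N (deform (Delta A) P) :
      Polynomial (MvPolynomial (Fin n) ℂ)) : PowerSeries (MvPolynomial (Fin n) ℂ)) =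
      deform (Delta A) P := by
    ext1 m
    rw [Polynomial.coeff_coe, PowerSeries.coeff_trunc]
    split_ifs with hm
    · rfl
    · rw [deform, PowerSeries.coeff_mk, (deformCoeff_eq_zero_iff _ _ _ _).2 (hN m (by omega))]
  refine ⟨(PowerSeries.trunc N (deform (Delta A) P) ^ k).natDegree + 1, fun m hm => ?_⟩
  have h := coeff_deform_pow A hnil m k
  rw [← hpoly, ← Polynomial.coe_pow, Polynomial.coeff_coe,
    Polynomial.coeff_eq_zero_of_natDegree_lt (by omega), eq_comm, smul_eq_zero] at h
  rw [← deformCoeff_eq_zero_iff]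
  exact h.resolve_left (by exact_mod_cast k.factorial_ne_zero)

/-- For a `Δ_A`-nilpotent `P` with `o(P) ≥ 2`, the following are equivalent:
(1) `Δ_A^m(P^{m+1}) = 0` for `m >> 0`; (2) `Δ_A^m(P^{m+k₀}) = 0` for `m >> 0` for some
`k₀ ≥ 1`; (3) for every `k ≥ 1`, `Δ_A^m(P^{m+k}) = 0` for `m >> 0`. -/
theorem stmt14 {n : ℕ} (A : Matrix (Fin n) (Fin n) ℂ) (hA : A.IsSymm)
    (P : MvPolynomial (Fin n) ℂ) (hP2 : OrdGe2 P) (hnil : LNil (Delta A) P) :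
    List.TFAE [
      ∃ N : ℕ, ∀ m : ℕ, N ≤ m → ((Delta A) ^ m) (P ^ (m + 1)) = 0,
      ∃ k₀ : ℕ, 1 ≤ k₀ ∧ ∃ N : ℕ, ∀ m : ℕ, N ≤ m → ((Delta A) ^ m) (P ^ (m + k₀)) = 0,
      ∀ k : ℕ, 1 ≤ k → ∃ N : ℕ, ∀ m : ℕ, N ≤ m → ((Delta A) ^ m) (P ^ (m + k)) = 0] := by
  tfae_have 1 → 3 := fun h k _ => eventually_of_eventually_one A hnil h k
  tfae_have 3 → 2 := fun h => ⟨1, le_rfl, h 1 le_rfl⟩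
  tfae_have 2 → 1 := by
    rintro ⟨k, hk, N, hN⟩
    refine ⟨N + k, fun m hm => ?_⟩
    obtain ⟨d, rfl⟩ := Nat.exists_eq_add_of_le' hk
    obtain ⟨l, rfl⟩ := Nat.exists_eq_add_of_le' (show d ≤ m by omega)
    rw [add_comm l d, pow_add, Module.End.mul_apply, show d + l + 1 = l + (d + 1) by ring,
      hN l (by omega), map_zero]
  tfae_finish
end

section
/- Let A ∈ SM(n, ℂ) and let P ∈ ℂ[z_1, …, z_n] be Δ_A-nilpotent with zero constant and linear terms (o(P) ≥ 2). Then Δ_A^m(P^{m+1}) = 0 for all sufficiently large m if and only if for every polynomial g ∈ ℂ[z_1, …, z_n] one has Δ_A^m(g·P^m) = 0 for all sufficiently large m. -/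
open MvPolynomial

open scoped PowerSeries in
/-- The derivation of `R⟦X⟧` applying `d` to every coefficient. -/
noncomputable def coeffwiseDerivation {R : Type*} [CommRing R] [Algebra ℂ R]
    (d : Derivation ℂ R R) : Derivation ℂ R⟦X⟧ R⟦X⟧ :=
  Derivation.mk'
    { toFun := fun f => PowerSeries.mk fun m => d (PowerSeries.coeff m f)
      map_add' := fun f g => by ext m; simp
      map_smul' := fun c f => by ext m; simp }
    (fun f g => by
      ext m
      simp only [LinearMap.coe_mk, AddHom.coe_mk, smul_eq_mul, map_add, PowerSeries.coeff_mk]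
      rw [mul_comm g, PowerSeries.coeff_mul, PowerSeries.coeff_mul, PowerSeries.coeff_mul, map_sum,
        ← Finset.sum_add_distrib]
      refine Finset.sum_congr rfl fun p _ => ?_
      simp [mul_comm])

open scoped PowerSeries in
theorem coeff_coeffwiseDerivation {R : Type*} [CommRing R] [Algebra ℂ R]
    (d : Derivation ℂ R R) (f : R⟦X⟧) (m : ℕ) :
    PowerSeries.coeff m (coeffwiseDerivation d f) = d (PowerSeries.coeff m f) := by
  simp [coeffwiseDerivation]

theorem Delta_apply {n : ℕ} (A : Matrix (Fin n) (Fin n) ℂ) (f : MvPolynomial (Fin n) ℂ) :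
    Delta A f = ∑ i, ∑ j, A i j • pderiv i (pderiv j f) := by
  simp [Delta, LinearMap.sum_apply]

/-- The operator `Delta A` acting on every coefficient of a power series. -/
noncomputable def coeffwiseDelta {n : ℕ} (A : Matrix (Fin n) (Fin n) ℂ)
    (f : PowerSeries (MvPolynomial (Fin n) ℂ)) : PowerSeries (MvPolynomial (Fin n) ℂ) :=
  ∑ i, ∑ j, A i j • coeffwiseDerivation (pderiv i) (coeffwiseDerivation (pderiv j) f)

theorem coeff_coeffwiseDelta {n : ℕ} (A : Matrix (Fin n) (Fin n) ℂ)
    (f : PowerSeries (MvPolynomial (Fin n) ℂ)) (m : ℕ) :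
    PowerSeries.coeff m (coeffwiseDelta A f) = Delta A (PowerSeries.coeff m f) := by
  simp [coeffwiseDelta, Delta_apply, coeff_coeffwiseDerivation]

/-- The quadratic form `∑ a_{ij} (D_i f) (D_j f)` on power series with polynomial coefficients. -/
noncomputable def gradientForm {n : ℕ} (A : Matrix (Fin n) (Fin n) ℂ)
    (f : PowerSeries (MvPolynomial (Fin n) ℂ)) : PowerSeries (MvPolynomial (Fin n) ℂ) :=
  ∑ i, ∑ j, A i j • (coeffwiseDerivation (pderiv i) f * coeffwiseDerivation (pderiv j) f)

theorem coeffwiseDelta_pow {n : ℕ} (A : Matrix (Fin n) (Fin n) ℂ)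
    (f : PowerSeries (MvPolynomial (Fin n) ℂ)) (hf : coeffwiseDelta A f = 0) (k : ℕ) :
    coeffwiseDelta A (f ^ (k + 2)) = ((k + 2) * (k + 1) : PowerSeries (MvPolynomial (Fin n) ℂ)) *
      (f ^ k * gradientForm A f) := by
  have h : coeffwiseDelta A (f ^ (k + 2)) =
      ((k + 2) * f ^ (k + 1) : PowerSeries (MvPolynomial (Fin n) ℂ)) * coeffwiseDelta A f +
      ((k + 2) * (k + 1) : PowerSeries (MvPolynomial (Fin n) ℂ)) * (f ^ k * gradientForm A f) := by
    simp only [coeffwiseDelta, gradientForm, Finset.mul_sum, ← Finset.sum_add_distrib]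
    refine Finset.sum_congr rfl fun i _ => Finset.sum_congr rfl fun j _ => ?_
    simp only [mul_smul_comm, ← smul_add]
    congr 1
    simp only [Derivation.leibniz_pow, Derivation.leibniz, map_nsmul, smul_eq_mul,
      Nat.add_sub_cancel, show k + 2 - 1 = k + 1 from rfl]
    simp only [nsmul_eq_mul]
    push_cast
    ring
  rw [h, hf, mul_zero, zero_add]

/-- The series `∑ k! / (m! (m+k)!) Δ^m (P^{m+k}) t^m`. -/
noncomputable def nilpotencySeries {n : ℕ} (A : Matrix (Fin n) (Fin n) ℂ)
    (P : MvPolynomial (Fin n) ℂ) (k : ℕ) : PowerSeries (MvPolynomial (Fin n) ℂ) :=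
  PowerSeries.mk fun m =>
    ((k.factorial : ℂ) / (m.factorial * (m + k).factorial)) • (Delta A ^ m) (P ^ (m + k))

theorem coeffwiseDelta_nilpotencySeries {n : ℕ} (A : Matrix (Fin n) (Fin n) ℂ)
    (P : MvPolynomial (Fin n) ℂ) (k : ℕ) :
    coeffwiseDelta A (nilpotencySeries A P (k + 1)) =
      ((k + 1 : ℕ) : PowerSeries (MvPolynomial (Fin n) ℂ)) *
        PowerSeries.derivative (MvPolynomial (Fin n) ℂ) (nilpotencySeries A P k) := by
  ext1 m
  rw [coeff_coeffwiseDelta, ← nsmul_eq_mul, map_nsmul, PowerSeries.coeff_derivative]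
  simp only [nilpotencySeries, PowerSeries.coeff_mk, map_smul]
  rw [← Module.End.mul_apply, ← pow_succ', show m + (k + 1) = m + 1 + k by ring]
  rw [← Nat.cast_smul_eq_nsmul ℂ, smul_mul_assoc, mul_comm _ ((m : MvPolynomial (Fin n) ℂ) + 1)]
  rw [show ((m : MvPolynomial (Fin n) ℂ) + 1) = MvPolynomial.C ((m : ℂ) + 1) by simp,
    ← MvPolynomial.smul_eq_C_mul, smul_smul, smul_smul]
  congr 1
  have h1 := Nat.cast_ne_zero (R := ℂ).mpr (Nat.factorial_ne_zero m)
  have h2 := Nat.cast_ne_zero (R := ℂ).mpr (Nat.factorial_ne_zero (m + 1 + k))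
  have h3 : (m : ℂ) + 1 ≠ 0 := by exact_mod_cast Nat.succ_ne_zero m
  rw [Nat.factorial_succ k, Nat.factorial_succ m]
  push_cast
  field_simp

theorem nilpotencySeries_zero {n : ℕ} (A : Matrix (Fin n) (Fin n) ℂ)
    (P : MvPolynomial (Fin n) ℂ) (hnil : LNil (Delta A) P) : nilpotencySeries A P 0 = 1 := by
  ext1 m
  rcases m with _ | m
  · simp [nilpotencySeries]
  · have h := hnil (m + 1) (by omega)
    simp [nilpotencySeries, h, PowerSeries.coeff_one]

open scoped PowerSeries in
theorem X_pow_dvd_coeffwiseDelta_sub {n : ℕ} (A : Matrix (Fin n) (Fin n) ℂ)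
    {f g : PowerSeries (MvPolynomial (Fin n) ℂ)} {m : ℕ} (h : PowerSeries.X ^ m ∣ f - g) :
    PowerSeries.X ^ m ∣ coeffwiseDelta A f - coeffwiseDelta A g := by
  rw [PowerSeries.X_pow_dvd_iff] at h ⊢
  intro j hj
  rw [map_sub, coeff_coeffwiseDelta, coeff_coeffwiseDelta, ← map_sub, ← map_sub, h j hj, map_zero]

theorem isUnit_natCast_succ {R : Type*} [CommRing R] [Algebra ℂ R] (k : ℕ) :
    IsUnit ((k + 1 : ℕ) : R) := by
  simpa using (isUnit_iff_ne_zero.mpr (Nat.cast_ne_zero (R := ℂ).mpr k.succ_ne_zero)).map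
    (algebraMap ℂ R)

open scoped PowerSeries in
theorem X_pow_succ_dvd_of_derivative {R : Type*} [CommRing R] [Algebra ℂ R] {f : R⟦X⟧} {m : ℕ}
    (h0 : PowerSeries.coeff 0 f = 0) (h : PowerSeries.X ^ m ∣ PowerSeries.derivative R f) :
    PowerSeries.X ^ (m + 1) ∣ f := by
  rw [PowerSeries.X_pow_dvd_iff] at h ⊢
  intro j hj
  rcases j with _ | j
  · exact h0
  · have h1 := h j (by omega)
    rw [PowerSeries.coeff_derivative] at h1
    have hu : IsUnit ((j : R) + 1) := by exact_mod_cast isUnit_natCast_succ j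
    exact hu.mul_left_eq_zero.mp h1

open scoped PowerSeries in
theorem X_pow_dvd_nilpotencySeries_sub_pow {n : ℕ} (A : Matrix (Fin n) (Fin n) ℂ)
    (P : MvPolynomial (Fin n) ℂ) (hnil : LNil (Delta A) P) (m : ℕ) :
    ∀ k, PowerSeries.X ^ m ∣ nilpotencySeries A P k - nilpotencySeries A P 1 ^ k := by
  have hharm : coeffwiseDelta A (nilpotencySeries A P 1) = 0 := by
    rw [coeffwiseDelta_nilpotencySeries, nilpotencySeries_zero A P hnil]
    simp
  set Q := nilpotencySeries A P 1 with hQ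
  induction m with
  | zero => simp
  | succ m ih =>
    have key (k : ℕ) : PowerSeries.X ^ m ∣ PowerSeries.derivative _ (nilpotencySeries A P (k + 1)) -
        ((k + 1 : ℕ) : PowerSeries (MvPolynomial (Fin n) ℂ)) * (Q ^ k * gradientForm A Q) := by
      have h := X_pow_dvd_coeffwiseDelta_sub A (ih (k + 2))
      rw [coeffwiseDelta_pow A Q hharm, coeffwiseDelta_nilpotencySeries] at h
      rw [← (isUnit_natCast_succ (k + 1)).dvd_mul_left]
      convert h using 1
      push_cast
      ring
    intro k
    rcases k with _ | k
    · simp [nilpotencySeries_zero A P hnil]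
    refine X_pow_succ_dvd_of_derivative ?_ ?_
    · have h0 (j : ℕ) : PowerSeries.constantCoeff (nilpotencySeries A P j) = P ^ j := by
        rw [← PowerSeries.coeff_zero_eq_constantCoeff_apply]
        simp [nilpotencySeries, Nat.factorial_ne_zero]
      simp [hQ, h0]
    · have h1 := key 0
      have h2 := (key k).sub (h1.mul_left (((k + 1 : ℕ) : PowerSeries _) * Q ^ k))
      convert h2 using 1
      rw [map_sub, Derivation.leibniz_pow]
      simp only [zero_add, ← hQ, smul_eq_mul, nsmul_eq_mul, Nat.add_sub_cancel]
      push_cast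
      ring

theorem nilpotencySeries_eq_pow {n : ℕ} (A : Matrix (Fin n) (Fin n) ℂ)
    (P : MvPolynomial (Fin n) ℂ) (hnil : LNil (Delta A) P) (k : ℕ) :
    nilpotencySeries A P k = nilpotencySeries A P 1 ^ k := by
  ext1 m
  have h := PowerSeries.X_pow_dvd_iff.mp
    (X_pow_dvd_nilpotencySeries_sub_pow A P hnil (m + 1) k) m m.lt_succ_self
  rwa [map_sub, sub_eq_zero] at h

theorem coeff_nilpotencySeries_eq_zero_iff {n : ℕ} (A : Matrix (Fin n) (Fin n) ℂ)
    (P : MvPolynomial (Fin n) ℂ) (k m : ℕ) :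
    PowerSeries.coeff m (nilpotencySeries A P k) = 0 ↔ (Delta A ^ m) (P ^ (m + k)) = 0 := by
  simp [nilpotencySeries, Nat.factorial_ne_zero]

theorem exists_forall_Delta_pow_eq_zero {n : ℕ} (A : Matrix (Fin n) (Fin n) ℂ)
    (P : MvPolynomial (Fin n) ℂ) (hnil : LNil (Delta A) P)
    (h : ∃ N : ℕ, ∀ m : ℕ, N ≤ m → (Delta A ^ m) (P ^ (m + 1)) = 0) (k : ℕ) :
    ∃ N : ℕ, ∀ m : ℕ, N ≤ m → (Delta A ^ m) (P ^ (m + k)) = 0 := by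
  obtain ⟨N, hN⟩ := h
  obtain ⟨q, hq⟩ : ∃ q : Polynomial (MvPolynomial (Fin n) ℂ),
      (q : PowerSeries (MvPolynomial (Fin n) ℂ)) = nilpotencySeries A P 1 := by
    refine ⟨PowerSeries.trunc N (nilpotencySeries A P 1), ?_⟩
    ext1 m
    rw [Polynomial.coeff_coe, PowerSeries.coeff_trunc]
    split_ifs with hm
    · rfl
    · exact ((coeff_nilpotencySeries_eq_zero_iff A P 1 m).mpr (hN m (not_lt.mp hm))).symm
  refine ⟨(q ^ k).natDegree + 1, fun m hm => ?_⟩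
  rw [← coeff_nilpotencySeries_eq_zero_iff, nilpotencySeries_eq_pow A P hnil, ← hq,
    ← Polynomial.coe_pow, Polynomial.coeff_coe]
  exact Polynomial.coeff_eq_zero_of_natDegree_lt hm

theorem Delta_mul_X {n : ℕ} (A : Matrix (Fin n) (Fin n) ℂ) (f : MvPolynomial (Fin n) ℂ)
    (l : Fin n) :
    Delta A (f * X l) = Delta A f * X l + ∑ i, (A i l + A l i) • pderiv i f := by
  have h (i j : Fin n) : A i j • pderiv i (pderiv j (f * X l)) =
      A i j • pderiv i (pderiv j f) * X l + (if i = l then A i j • pderiv j f else 0) +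
        if j = l then A i j • pderiv i f else 0 := by
    have hd (i : Fin n) : pderiv i (X l : MvPolynomial (Fin n) ℂ) = if i = l then 1 else 0 := by
      simp [pderiv_X, Pi.single_apply, eq_comm]
    simp only [Derivation.leibniz, hd, map_add, smul_eq_mul, MvPolynomial.smul_eq_C_mul]
    split_ifs <;> simp <;> ring
  simp only [Delta_apply, h, Finset.sum_add_distrib, Finset.sum_mul, add_smul]
  simp [Finset.sum_ite_irrel, add_assoc, add_comm]

theorem pderiv_pderiv_comm {σ R : Type*} [CommRing R] (i j : σ) (f : MvPolynomial σ R) :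
    pderiv i (pderiv j f) = pderiv j (pderiv i f) := by
  have h : ⁅(pderiv i : Derivation R (MvPolynomial σ R) (MvPolynomial σ R)),
      (pderiv j : Derivation R (MvPolynomial σ R) (MvPolynomial σ R))⁆ = 0 := by
    classical
    ext1 l
    simp [Derivation.commutator_apply, pderiv_X, Pi.single_apply, apply_ite]
  have := DFunLike.congr_fun h f
  rwa [Derivation.commutator_apply, Derivation.coe_zero, Pi.zero_apply, sub_eq_zero] at this

theorem commute_Delta_pderiv {n : ℕ} (A : Matrix (Fin n) (Fin n) ℂ) (l : Fin n) :
    Commute (Delta A) (pderiv l).toLinearMap := by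
  refine LinearMap.ext fun f => ?_
  simp only [Module.End.mul_apply, Delta_apply, Derivation.coeFn_coe, map_sum, map_smul]
  exact Finset.sum_congr rfl fun i _ => Finset.sum_congr rfl fun j _ => by
    rw [pderiv_pderiv_comm l i, pderiv_pderiv_comm l j]

theorem Delta_pow_mul_X {n : ℕ} (A : Matrix (Fin n) (Fin n) ℂ) (f : MvPolynomial (Fin n) ℂ)
    (l : Fin n) (m : ℕ) :
    (Delta A ^ (m + 1)) (f * X l) = (Delta A ^ (m + 1)) f * X l +
      (m + 1 : ℕ) • ∑ i, (A i l + A l i) • pderiv i ((Delta A ^ m) f) := by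
  induction m with
  | zero => simp [Delta_mul_X]
  | succ m ih =>
    have hc (i : Fin n) (g : MvPolynomial (Fin n) ℂ) :
        Delta A (pderiv i g) = pderiv i (Delta A g) :=
      LinearMap.congr_fun (commute_Delta_pderiv A i).eq g
    rw [pow_succ', Module.End.mul_apply, ih, map_add, Delta_mul_X, map_nsmul, map_sum]
    simp only [map_smul, hc, ← Module.End.mul_apply, ← pow_succ']
    rw [add_assoc, ← succ_nsmul']

/-- For a `Δ_A`-nilpotent `P` with `o(P) ≥ 2`: `Δ_A^m(P^{m+1}) = 0` for `m >> 0` iff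
for every `g ∈ ℂ[z]`, `Δ_A^m(g P^m) = 0` for `m >> 0`. -/
theorem stmt15 {n : ℕ} (A : Matrix (Fin n) (Fin n) ℂ) (hA : A.IsSymm)
    (P : MvPolynomial (Fin n) ℂ) (hP2 : OrdGe2 P) (hnil : LNil (Delta A) P) :
    (∃ N : ℕ, ∀ m : ℕ, N ≤ m → ((Delta A) ^ m) (P ^ (m + 1)) = 0) ↔
    (∀ g : MvPolynomial (Fin n) ℂ,
      ∃ N : ℕ, ∀ m : ℕ, N ≤ m → ((Delta A) ^ m) (g * P ^ m) = 0) := by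
  constructor
  · intro h g
    suffices H : ∀ k : ℕ, ∃ N : ℕ, ∀ m : ℕ, N ≤ m → (Delta A ^ m) (g * P ^ (m + k)) = 0 from H 0
    induction g using MvPolynomial.induction_on with
    | C a =>
      intro k
      obtain ⟨N, hN⟩ := exists_forall_Delta_pow_eq_zero A P hnil h k
      refine ⟨N, fun m hm => ?_⟩
      rw [← MvPolynomial.smul_eq_C_mul, map_smul, hN m hm, smul_zero]
    | add p q hp hq =>
      intro k
      obtain ⟨N, hN⟩ := hp k
      obtain ⟨M, hM⟩ := hq k
      refine ⟨max N M, fun m hm => ?_⟩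
      rw [add_mul, map_add, hN m (le_of_max_le_left hm), hM m (le_of_max_le_right hm), add_zero]
    | mul_X p l hp =>
      intro k
      obtain ⟨N, hN⟩ := hp k
      obtain ⟨M, hM⟩ := hp (k + 1)
      refine ⟨max N M + 1, fun m hm => ?_⟩
      obtain ⟨m, rfl⟩ : ∃ r, m = r + 1 := ⟨m - 1, by omega⟩
      have h1 := hN (m + 1) (by omega)
      have h2 := hM m (by omega)
      rw [show m + (k + 1) = m + 1 + k by ring] at h2
      rw [mul_right_comm, Delta_pow_mul_X, h1, h2]
      simp
  · intro h
    obtain ⟨N, hN⟩ := h P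
    exact ⟨N, fun m hm => by rw [pow_succ']; exact hN m hm⟩
end

section
/- Let δ = Σ_{i=1}^n c_i D_i be a first-order homogeneous constant-coefficient differential operator on ℂ[z_1, …, z_n], and let Λ = δ^k for some k ≥ 1. Then: (a) any polynomial P ∈ ℂ[z_1, …, z_n] with Λ P = 0 is Λ-nilpotent; and (b) VC[n] holds for Λ, i.e., for every Λ-nilpotent polynomial P there exists N such that Λ^m(P^{m+1}) = 0 for all m ≥ N. -/
open MvPolynomial

/-- The Vanishing Conjecture holds for `Λ`. -/
def VC {n : ℕ} (Λ : Module.End ℂ (MvPolynomial (Fin n) ℂ)) : Prop :=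
  ∀ P : MvPolynomial (Fin n) ℂ, LNil Λ P →
    ∃ N : ℕ, ∀ m : ℕ, N ≤ m → (Λ ^ m) (P ^ (m + 1)) = 0

/-- The first-order constant-coefficient operator `β_D = Σ βᵢ Dᵢ`. -/
noncomputable def betaD {n : ℕ} (β : Fin n → ℂ) : Module.End ℂ (MvPolynomial (Fin n) ℂ) :=
  ∑ i, β i • (pderiv i).toLinearMap

/-- If a derivation `D` satisfies `D ^ a f = 0` and `D ^ b g = 0`, then `D ^ s` kills `f * g`
as soon as `a + b ≤ s + 1`. -/
theorem Derivation.pow_apply_mul_eq_zero {R A : Type*} [CommRing R] [CommRing A] [Algebra R A]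
    (D : Derivation R A A) {a b s : ℕ} {f g : A} (hs : a + b ≤ s + 1)
    (hf : ((D : Module.End R A) ^ a) f = 0) (hg : ((D : Module.End R A) ^ b) g = 0) :
    ((D : Module.End R A) ^ s) (f * g) = 0 := by
  induction s generalizing a b f g with
  | zero =>
    obtain rfl | rfl : a = 0 ∨ b = 0 := by omega
    · simp_all
    · simp_all
  | succ s ih =>
    rcases a with _ | a
    · simp_all
    rcases b with _ | b
    · simp_all
    have h₁ := ih (show a + 1 + b ≤ s + 1 by omega) hf (by rwa [pow_succ] at hg)
    have h₂ := ih (show b + 1 + a ≤ s + 1 by omega) hg (by rwa [pow_succ] at hf)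
    rw [pow_succ, Module.End.mul_apply, Derivation.coeFn_coe, Derivation.leibniz, map_add,
      smul_eq_mul, smul_eq_mul]
    exact (congrArg₂ (· + ·) h₁ h₂).trans (add_zero 0)

/-- If a derivation `D` satisfies `D ^ (j + 1) f = 0`, then `D ^ s` kills `f ^ m` for all
`s > m * j`. -/
theorem Derivation.pow_apply_pow_eq_zero {R A : Type*} [CommRing R] [CommRing A] [Algebra R A]
    (D : Derivation R A A) {j : ℕ} {f : A} (hf : ((D : Module.End R A) ^ (j + 1)) f = 0)
    {m s : ℕ} (hs : m * j < s) : ((D : Module.End R A) ^ s) (f ^ m) = 0 := by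
  induction m generalizing s with
  | zero =>
    obtain ⟨s, rfl⟩ : ∃ t, s = t + 1 := ⟨s - 1, by omega⟩
    simp [pow_succ]
  | succ m ih =>
    rw [pow_succ]
    refine D.pow_apply_mul_eq_zero ?_ (ih (Nat.lt_succ_self (m * j))) hf
    rw [add_mul] at hs
    omega

theorem exists_derivation_eq_betaD {n : ℕ} (c : Fin n → ℂ) :
    ∃ D : Derivation ℂ (MvPolynomial (Fin n) ℂ) (MvPolynomial (Fin n) ℂ),
      betaD c = (D : Module.End ℂ (MvPolynomial (Fin n) ℂ)) := by
  refine ⟨∑ i, c i • pderiv i, LinearMap.ext fun p => ?_⟩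
  simp only [betaD, LinearMap.sum_apply, LinearMap.smul_apply, Derivation.coeFn_coe]
  rw [← Derivation.coeFnAddMonoidHom_apply, map_sum, Finset.sum_apply]
  rfl

/-- For `Λ = δ^k` with `δ = Σ cᵢ Dᵢ` first order with constant coefficients and `k ≥ 1`:
(a) any `P` with `Λ P = 0` is `Λ`-nilpotent; (b) `VC[n]` holds for `Λ`. -/
theorem stmt17 {n : ℕ} (c : Fin n → ℂ) (k : ℕ) (hk : 1 ≤ k) :
    (∀ P : MvPolynomial (Fin n) ℂ, ((betaD c) ^ k) P = 0 → LNil ((betaD c) ^ k) P) ∧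
    VC ((betaD c) ^ k) := by
  obtain ⟨D, hD⟩ := exists_derivation_eq_betaD c
  obtain ⟨j, rfl⟩ : ∃ j, k = j + 1 := ⟨k - 1, by omega⟩
  rw [hD]
  refine ⟨fun P hP m hm => ?_, fun P hP => ⟨j + 1, fun m hm => ?_⟩⟩
  · rw [← pow_mul]
    exact D.pow_apply_pow_eq_zero hP (by nlinarith)
  · rw [← pow_mul]
    exact D.pow_apply_pow_eq_zero (by simpa using hP 1 le_rfl) (by nlinarith)
end

section
/- Let A ∈ SM(n, ℂ) be invertible and let P ∈ ℂ[z_1, …, z_n] be a homogeneous Δ_A-nilpotent polynomial of degree d ≥ 3. Let 𝓘(P) be the ideal of ℂ[z_1, …, z_n] generated by σ_{A^{-1}}(z) := z^T A^{-1} z and the partial derivatives ∂P/∂z_1, …, ∂P/∂z_n. Then for every f ∈ 𝓘(P) and every m ≥ 0, f(AD)(Δ_A^m P^{m+1}) = 0, where f(AD) is the constant-coefficient differential operator obtained by substituting Σ_{j=1}^n a_{ij} D_j for z_i in f. -/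
open MvPolynomial

/-- The `i`-th entry of the vector of operators `AD`, i.e. `Σⱼ aᵢⱼ Dⱼ`. -/
noncomputable def LD {n : ℕ} (A : Matrix (Fin n) (Fin n) ℂ) (i : Fin n) :
    Module.End ℂ (MvPolynomial (Fin n) ℂ) :=
  ∑ j, A i j • (pderiv j).toLinearMap

/-- The constant-coefficient differential operator `f(AD)`, obtained by substituting
`Σⱼ aᵢⱼ Dⱼ` for `zᵢ` in `f`. -/
noncomputable def opOf {n : ℕ} (A : Matrix (Fin n) (Fin n) ℂ)
    (f : MvPolynomial (Fin n) ℂ) : Module.End ℂ (MvPolynomial (Fin n) ℂ) :=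
  ∑ d ∈ f.support, MvPolynomial.coeff d f • (List.ofFn fun i => (LD A i) ^ (d i)).prod

theorem commute_pderiv {σ R : Type*} [CommRing R] (i j : σ) :
    Commute ((pderiv i).toLinearMap : Module.End R (MvPolynomial σ R))
      (pderiv j).toLinearMap := by
  classical
  have h : ⁅pderiv (R := R) i, pderiv (R := R) j⁆ = 0 := by
    refine MvPolynomial.derivation_ext fun k => ?_
    rw [Derivation.commutator_apply, pderiv_X, pderiv_X]
    rcases eq_or_ne k i with rfl | hi <;> rcases eq_or_ne k j with rfl | hj <;>
      simp_all
  refine LinearMap.ext fun p => ?_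
  have hp := DFunLike.congr_fun h p
  rw [Derivation.commutator_apply, Derivation.zero_apply, sub_eq_zero] at hp
  exact hp

open scoped IsMulCommutative in
/-- Evaluation of polynomials at a commuting family of elements of an algebra. -/
theorem exists_algHom_of_commute {R E : Type*} [CommRing R] [Ring E] [Algebra R E] {n : ℕ}
    {x : Fin n → E} (hx : ∀ i j, Commute (x i) (x j)) :
    ∃ φ : MvPolynomial (Fin n) R →ₐ[R] E,
      (∀ f, φ f = ∑ d ∈ f.support, coeff d f • (List.ofFn fun i => x i ^ d i).prod) ∧
        ∀ i, φ (X i) = x i := by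
  have hcomm : ∀ y ∈ Set.range x, ∀ z ∈ Set.range x, y * z = z * y := by
    rintro _ ⟨i, rfl⟩ _ ⟨j, rfl⟩
    exact hx i j
  have := Algebra.isMulCommutative_adjoin R hcomm
  let y : Fin n → Algebra.adjoin R (Set.range x) :=
    fun i => ⟨x i, Algebra.subset_adjoin ⟨i, rfl⟩⟩
  refine ⟨(Subalgebra.val _).comp (aeval y), fun f => ?_, fun i => ?_⟩
  · rw [AlgHom.comp_apply, aeval_def, eval₂_eq', map_sum]
    refine Finset.sum_congr rfl fun d _ => ?_
    rw [← List.prod_ofFn, ← Algebra.smul_def, map_smul, map_list_prod, List.map_ofFn]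
    rfl
  · rw [AlgHom.comp_apply, aeval_X]
    rfl

section

variable {n : ℕ} (A : Matrix (Fin n) (Fin n) ℂ)

theorem commute_pderiv_LD (i j : Fin n) : Commute (pderiv i).toLinearMap (LD A j) :=
  Commute.sum_right _ _ _ fun k _ => (commute_pderiv i k).smul_right _

theorem commute_LD (i j : Fin n) : Commute (LD A i) (LD A j) :=
  Commute.sum_left _ _ _ fun k _ => (commute_pderiv_LD A k j).smul_left _

theorem commute_pderiv_Delta (i : Fin n) : Commute (pderiv i).toLinearMap (Delta A) :=
  Commute.sum_right _ _ _ fun j _ => Commute.sum_right _ _ _ fun k _ =>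
    ((commute_pderiv i j).mul_right (commute_pderiv i k)).smul_right _

theorem commute_LD_Delta (i : Fin n) : Commute (LD A i) (Delta A) :=
  Commute.sum_left _ _ _ fun k _ => (commute_pderiv_Delta A k).smul_left _

/-- The substitution `f ↦ f(AD)` is an algebra homomorphism. -/
theorem exists_algHom_eq_opOf :
    ∃ φ : MvPolynomial (Fin n) ℂ →ₐ[ℂ] Module.End ℂ (MvPolynomial (Fin n) ℂ),
      (∀ f, φ f = opOf A f) ∧ ∀ i, φ (X i) = LD A i :=
  exists_algHom_of_commute (commute_LD A)

theorem opOf_mul (f g : MvPolynomial (Fin n) ℂ) : opOf A (f * g) = opOf A f * opOf A g := by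
  obtain ⟨φ, h, -⟩ := exists_algHom_eq_opOf A
  simp only [← h, map_mul]

theorem opOf_add (f g : MvPolynomial (Fin n) ℂ) : opOf A (f + g) = opOf A f + opOf A g := by
  obtain ⟨φ, h, -⟩ := exists_algHom_eq_opOf A
  simp only [← h, map_add]

theorem opOf_zero : opOf A 0 = 0 := by
  obtain ⟨φ, h, -⟩ := exists_algHom_eq_opOf A
  simp only [← h, map_zero]

theorem opOf_C (a : ℂ) : opOf A (C a) = algebraMap ℂ _ a := by
  obtain ⟨φ, h, -⟩ := exists_algHom_eq_opOf A
  rw [← h, ← algebraMap_eq, AlgHom.commutes]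

theorem opOf_X (i : Fin n) : opOf A (X i) = LD A i := by
  obtain ⟨φ, h, hX⟩ := exists_algHom_eq_opOf A
  rw [← h, hX]

/-- `σ_{A⁻¹}(AD) = Δ_A`. -/
theorem opOf_quadraticForm_inv (hA : A.IsSymm) (hAu : IsUnit A) :
    opOf A (∑ i, ∑ j, C (A⁻¹ i j) * X i * X j) = Delta A := by
  obtain ⟨φ, h, hX⟩ := exists_algHom_eq_opOf A
  have hdet := (Matrix.isUnit_iff_isUnit_det A).mp hAu
  have hLD (i : Fin n) : ∑ j, A⁻¹ i j • LD A j = (pderiv i).toLinearMap := by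
    simp only [LD, Finset.smul_sum, smul_smul]
    rw [Finset.sum_comm]
    simp only [← Finset.sum_smul, ← Matrix.mul_apply, Matrix.nonsing_inv_mul A hdet,
      Matrix.one_apply, ite_smul, one_smul, zero_smul, Finset.sum_ite_eq, Finset.mem_univ, if_true]
  rw [← h]
  simp only [map_sum, map_mul, hX, ← algebraMap_eq, ← Algebra.smul_def, map_smul]
  calc ∑ i, ∑ j, (A⁻¹ i j • LD A i) * LD A j
      = ∑ i, LD A i * (pderiv i).toLinearMap := by
        simp only [← hLD, Finset.mul_sum, smul_mul_assoc, mul_smul_comm]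
    _ = Delta A := by
        simp only [LD, Delta, Finset.sum_mul, smul_mul_assoc]
        rw [Finset.sum_comm]
        refine Finset.sum_congr rfl fun i _ => Finset.sum_congr rfl fun j _ => ?_
        rw [hA.apply i j]
        rfl

variable {A}

theorem Delta_X_mul (hA : A.IsSymm) (i : Fin n) (f : MvPolynomial (Fin n) ℂ) :
    Delta A (X i * f) = X i * Delta A f + (2 : ℂ) • LD A i f := by
  have hterm (j k : Fin n) : pderiv j (pderiv k (X i * f)) =
      X i * pderiv j (pderiv k f) + (if k = i then pderiv j f else 0) +
        (if j = i then pderiv k f else 0) := by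
    simp only [pderiv_mul, pderiv_X, Pi.single_apply, map_add, eq_comm (a := i)]
    split_ifs <;> simp <;> ring
  simp only [Delta, LD, LinearMap.sum_apply, LinearMap.smul_apply, LinearMap.comp_apply,
    Derivation.coeFn_coe, hterm, smul_add, Finset.sum_add_distrib,
    smul_ite, smul_zero, Finset.sum_ite_eq', Finset.mem_univ, if_true, Finset.mul_sum,
    mul_smul_comm, two_smul, add_assoc]
  congr 2
  · exact Finset.sum_congr rfl fun j _ => by rw [hA.apply i j]
  · rw [Finset.sum_comm]
    simp

theorem Delta_pow_succ_X_mul (hA : A.IsSymm) (i : Fin n) (k : ℕ) (f : MvPolynomial (Fin n) ℂ) :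
    (Delta A ^ (k + 1)) (X i * f) =
      X i * (Delta A ^ (k + 1)) f + (2 * (k + 1) : ℂ) • LD A i ((Delta A ^ k) f) := by
  have hcomm (g : MvPolynomial (Fin n) ℂ) : Delta A (LD A i g) = LD A i (Delta A g) :=
    (DFunLike.congr_fun (commute_LD_Delta A i).eq g).symm
  induction k with
  | zero => simpa using Delta_X_mul hA i f
  | succ k ih =>
    rw [pow_succ', Module.End.mul_apply, ih, map_add, Delta_X_mul hA, map_smul, hcomm,
      ← Module.End.mul_apply, ← Module.End.mul_apply (Delta A) (Delta A ^ k), ← pow_succ',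
      ← pow_succ', add_assoc, ← add_smul]
    congr 2
    push_cast
    ring

/-- If `Δ^(N+1) f = 0` and `g` is homogeneous of degree `e`, then `Δ^(N+e)` maps `g f` to a
multiple of `g(AD) (Δ^N f)`, and the next power kills `g f`. -/
theorem Delta_pow_mul (hA : A.IsSymm) {e : ℕ} {g : MvPolynomial (Fin n) ℂ}
    (hg : g.IsHomogeneous e) {N : ℕ} {f : MvPolynomial (Fin n) ℂ}
    (hf : (Delta A ^ (N + 1)) f = 0) :
    (Delta A ^ (N + e + 1)) (g * f) = 0 ∧
      (Delta A ^ (N + e)) (g * f) =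
        ((2 ^ e * (N + 1).ascFactorial e : ℕ) : ℂ) • opOf A g ((Delta A ^ N) f) := by
  have hmon (s : Fin n →₀ ℕ) (a : ℂ) : ∃ e, (monomial s a).IsHomogeneous e ∧
      (Delta A ^ (N + e + 1)) (monomial s a * f) = 0 ∧
      (Delta A ^ (N + e)) (monomial s a * f) =
        ((2 ^ e * (N + 1).ascFactorial e : ℕ) : ℂ) •
          opOf A (monomial s a) ((Delta A ^ N) f) := by
    refine induction_on_monomial (fun a => ⟨0, isHomogeneous_C _ a, ?_, ?_⟩) ?_ s a
    · rw [C_mul', map_smul, add_zero, hf, smul_zero]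
    · rw [C_mul', map_smul, opOf_C]
      simp
    · rintro p i ⟨e, hp, h0, h1⟩
      refine ⟨e + 1, hp.mul (isHomogeneous_X _ i), ?_, ?_⟩
      · rw [mul_comm p, mul_assoc, Delta_pow_succ_X_mul hA, ← add_assoc, pow_succ',
          Module.End.mul_apply, h0]
        simp
      · rw [mul_comm p, mul_assoc, ← add_assoc, Delta_pow_succ_X_mul hA, h0, h1, mul_zero, zero_add,
          opOf_mul, opOf_X, Module.End.mul_apply, map_smul, smul_smul, Nat.ascFactorial_succ]
        congr 1
        push_cast
        ring
  have hsum : ∀ s ∈ g.support, (Delta A ^ (N + e + 1)) (monomial s (coeff s g) * f) = 0 ∧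
      (Delta A ^ (N + e)) (monomial s (coeff s g) * f) =
        ((2 ^ e * (N + 1).ascFactorial e : ℕ) : ℂ) •
          opOf A (monomial s (coeff s g)) ((Delta A ^ N) f) := by
    intro s hs
    have hne : coeff s g ≠ 0 := mem_support_iff.mp hs
    obtain ⟨e', he', h⟩ := hmon s (coeff s g)
    have : e' = e := by
      rw [← hg hne]
      exact (he' (d := s) (by simpa using hne)).symm
    exact this ▸ h
  obtain ⟨φ, hφ, -⟩ := exists_algHom_eq_opOf A
  simp only [← hφ] at hsum ⊢
  rw [g.as_sum]
  simp only [Finset.sum_mul, map_sum, LinearMap.sum_apply, Finset.smul_sum]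
  exact ⟨Finset.sum_eq_zero fun s hs => (hsum s hs).1,
    Finset.sum_congr rfl fun s hs => (hsum s hs).2⟩

theorem opOf_pderiv_Delta_pow (hA : A.IsSymm) {d : ℕ} (hd : 3 ≤ d)
    {P : MvPolynomial (Fin n) ℂ} (hP : P.IsHomogeneous d) (hnil : LNil (Delta A) P)
    (i : Fin n) (m : ℕ) : opOf A (pderiv i P) ((Delta A ^ m) (P ^ (m + 1))) = 0 := by
  have hzero : (Delta A ^ (m + (d - 1))) (pderiv i P * P ^ (m + 1)) = 0 := by
    have h2 : (Delta A ^ (m + (d - 1))) (P ^ (m + 2)) = 0 := by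
      obtain ⟨k, hk⟩ : ∃ k, m + (d - 1) = k + (m + 2) := ⟨d - 3, by omega⟩
      rw [hk, pow_add, Module.End.mul_apply, hnil _ (by omega), map_zero]
    have h3 := DFunLike.congr_fun ((commute_pderiv_Delta A i).pow_right (m + (d - 1))).eq
      (P ^ (m + 2))
    rw [Module.End.mul_apply, Module.End.mul_apply, h2, map_zero] at h3
    have h4 : (pderiv i).toLinearMap (P ^ (m + 2)) =
        ((m + 2 : ℕ) : ℂ) • (pderiv i P * P ^ (m + 1)) := by
      rw [Derivation.coeFn_coe, pderiv_pow, Nat.cast_smul_eq_nsmul,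
        nsmul_eq_mul, show m + 2 - 1 = m + 1 from rfl]
      ring
    rw [h4, map_smul, eq_comm, smul_eq_zero] at h3
    exact h3.resolve_left (by norm_cast)
  have h := (Delta_pow_mul hA (hP.pderiv (i := i)) (hnil (m + 1) (by omega))).2
  rw [hzero, eq_comm, smul_eq_zero] at h
  refine h.resolve_left (Nat.cast_ne_zero.mpr ?_)
  positivity

end

/-- For a homogeneous `Δ_A`-nilpotent `P` of degree `d ≥ 3`, every `f` in the ideal
generated by `σ_{A⁻¹}(z)` and the partials of `P` satisfies
`f(AD)(Δ_A^m P^{m+1}) = 0` for all `m ≥ 0`. -/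
theorem stmt18 {n : ℕ} (A : Matrix (Fin n) (Fin n) ℂ) (hA : A.IsSymm) (hAu : IsUnit A)
    {d : ℕ} (hd : 3 ≤ d) (P : MvPolynomial (Fin n) ℂ) (hP : P.IsHomogeneous d)
    (hnil : LNil (Delta A) P) :
    ∀ f ∈ Ideal.span
        (insert (∑ i, ∑ j, C ((A⁻¹) i j) * X i * X j)
          (Set.range fun i => pderiv i P)),
      ∀ m : ℕ, (opOf A f) (((Delta A) ^ m) (P ^ (m + 1))) = 0 := by
  intro f hf m
  induction hf using Submodule.span_induction with
  | mem f hf =>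
    rcases hf with rfl | ⟨i, rfl⟩
    · rw [opOf_quadraticForm_inv A hA hAu, ← Module.End.mul_apply, ← pow_succ']
      exact hnil _ (by omega)
    · exact opOf_pderiv_Delta_pow hA hd hP hnil i m
  | zero => rw [opOf_zero, LinearMap.zero_apply]
  | add f g _ _ hf hg => rw [opOf_add, LinearMap.add_apply, hf, hg, add_zero]
  | smul a f _ hf => rw [smul_eq_mul, opOf_mul, Module.End.mul_apply, hf, map_zero]
end
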